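/- Let A and B be disjoint computably enumerable subsets of ℕ. There exists a computable nondecreasing function f : [0,1] → ℝ (computable in the sense of computable analysis) such that for every e, if e ∈ A then f(2^{-e}) < 2^{-e} and if e ∈ B then f(2^{-e}) > 2^{-e}. Consequently, any oracle deciding for all e whether f(2^{-e}) < 2^{-e} or f(2^{-e}) > 2^{-e} computes a separating set X with A ⊆ X ⊆ ℕ \ B. -/

import Mathlib

/-- `A` is computably enumerable: some computable predicate enumerates it in stages. -/
def CEset (A : Set ℕ) : Prop :=
  ∃ p : ℕ → ℕ → Bool, Computable₂ p ∧ ∀ n, n ∈ A ↔ ∃ s, p n s = true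

theorem Computable.of_find {α : Type*} [Primcodable α] {f : α → ℕ} {P : α → ℕ → Bool}
    (hP : Computable₂ P) (hf : ∀ a n, P a n = true ↔ n = f a) : Computable f := by
  refine Partrec.of_eq_tot (Partrec.rfind (p := fun a n => Part.some (P a n)) hP) fun a => ?_
  refine Nat.mem_rfind.2 ⟨by simpa using ((hf a (f a)).2 rfl).symm, fun {m} hm => ?_⟩
  have : P a m ≠ true := fun h => hm.ne ((hf a m).1 h)
  simpa using this

namespace Rat

/-- The code of a rational as the pair of its numerator and its denominator. -/
def pairCode (q : ℚ) : ℕ := @Encodable.encode ℚ Rat.instEncodable q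

theorem pairCode_eq (q : ℚ) : q.pairCode = Nat.pair (Equiv.intEquivNat q.num) q.den := rfl

theorem intEquivNat_eq (z : ℤ) :
    Equiv.intEquivNat z = if 0 ≤ z then 2 * z.natAbs else 2 * z.natAbs - 1 := by
  cases z with
  | ofNat n =>
    rw [show Equiv.intEquivNat (Int.ofNat n) = 2 * n from rfl]
    simp
  | negSucc n =>
    rw [show Equiv.intEquivNat (Int.negSucc n) = 2 * n + 1 from rfl]
    simp
    omega

theorem natAbs_intEquivNat_symm (k : ℕ) :
    (Equiv.intEquivNat.symm k).natAbs = (k + 1) / 2 := by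
  obtain ⟨z, rfl⟩ := Equiv.intEquivNat.surjective k
  rw [Equiv.symm_apply_apply, intEquivNat_eq]
  split_ifs <;> omega

/-- The pairs that code a rational in lowest terms. -/
def IsPairCode (m : ℕ) : Prop :=
  0 < m.unpair.2 ∧ ∀ x < m.unpair.2 + 1,
    ((m.unpair.1 + 1) / 2 % x = 0 ∧ m.unpair.2 % x = 0) → x = 1

instance : DecidablePred IsPairCode := fun m => by unfold IsPairCode; infer_instance

theorem mem_range_pairCode (m : ℕ) : m ∈ Set.range pairCode ↔ IsPairCode m := by
  have key : IsPairCode m ↔ 0 < m.unpair.2 ∧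
      ((Equiv.intEquivNat.symm m.unpair.1).natAbs).Coprime m.unpair.2 := by
    rw [natAbs_intEquivNat_symm]
    refine and_congr_right fun h0 => ⟨fun h => ?_, fun h x _ hx => ?_⟩
    · refine h _ (Nat.lt_succ_of_le (Nat.gcd_le_right _ h0)) ⟨?_, ?_⟩
      · exact Nat.mod_eq_zero_of_dvd (Nat.gcd_dvd_left _ _)
      · exact Nat.mod_eq_zero_of_dvd (Nat.gcd_dvd_right _ _)
    · exact Nat.eq_one_of_dvd_coprimes h (Nat.dvd_of_mod_eq_zero hx.1)
        (Nat.dvd_of_mod_eq_zero hx.2)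
  rw [key]
  constructor
  · rintro ⟨q, rfl⟩
    simpa [pairCode_eq] using ⟨q.pos, q.reduced⟩
  · rintro ⟨h0, hc⟩
    exact ⟨⟨Equiv.intEquivNat.symm m.unpair.1, m.unpair.2, h0.ne', hc⟩, by simp [pairCode_eq]⟩

theorem primrecPred_isPairCode : PrimrecPred IsPairCode := by
  have hd : Primrec fun m : ℕ => m.unpair.2 := Primrec.snd.comp Primrec.unpair
  have hn : Primrec fun m : ℕ => (m.unpair.1 + 1) / 2 :=
    Primrec.nat_div.comp (Primrec.succ.comp (Primrec.fst.comp Primrec.unpair)) (Primrec.const 2)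
  refine PrimrecPred.and (Primrec.nat_lt.comp (Primrec.const 0) hd) ?_
  have hR : PrimrecRel fun (x m : ℕ) =>
      ((m.unpair.1 + 1) / 2 % x = 0 ∧ m.unpair.2 % x = 0) → x = 1 := by
    have h1 : PrimrecPred fun p : ℕ × ℕ => (p.2.unpair.1 + 1) / 2 % p.1 = 0 :=
      Primrec.eq.comp (Primrec.nat_mod.comp (hn.comp Primrec.snd) Primrec.fst) (Primrec.const 0)
    have h2 : PrimrecPred fun p : ℕ × ℕ => p.2.unpair.2 % p.1 = 0 :=
      Primrec.eq.comp (Primrec.nat_mod.comp (hd.comp Primrec.snd) Primrec.fst) (Primrec.const 0)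
    have h3 : PrimrecPred fun p : ℕ × ℕ => p.1 = 1 :=
      Primrec.eq.comp Primrec.fst (Primrec.const 1)
    exact ((h1.and h2).not.or h3).of_eq fun p => by simp only [imp_iff_not_or]
  exact hR.forall_lt.comp (Primrec.succ.comp hd) Primrec.id

theorem encode_eq_count (q : ℚ) :
    @Encodable.encode ℚ Denumerable.toEncodable q = Nat.count IsPairCode q.pairCode := by
  rw [Nat.count]
  have : @Encodable.encode ℚ Denumerable.toEncodable q =
    @List.countP ℕ (fun m => @decide _ (@Encodable.decidableRangeEncode ℚ _ m))
      (List.range q.pairCode) := rfl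
  rw [this]
  congr 1
  funext m
  rw [decide_eq_decide]
  exact mem_range_pairCode m

theorem computable_pairCode : Computable pairCode := by
  have hc : Computable (Nat.count IsPairCode) := by
    refine (Primrec.nat_rec₁ (f := fun n k => k + if IsPairCode n then 1 else 0) 0 ?_).to_comp.of_eq
      fun n => ?_
    · exact Primrec.nat_add.comp Primrec.snd (Primrec.ite (primrecPred_isPairCode.comp Primrec.fst)
        (Primrec.const 1) (Primrec.const 0))
    · induction n with
      | zero => rfl
      | succ n ih => rw [Nat.count_succ, ← ih]
  have he : Computable fun q : ℚ => @Encodable.encode ℚ Denumerable.toEncodable q :=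
    Computable.encode
  refine Computable.of_find (P := fun q m => decide (IsPairCode m) &&
    decide (Nat.count IsPairCode m = @Encodable.encode ℚ Denumerable.toEncodable q)) ?_ ?_
  · refine Primrec.and.to_comp.comp (primrecPred_isPairCode.decide.to_comp.comp Computable.snd) ?_
    exact Primrec.eq.decide.to_comp.comp (hc.comp Computable.snd) (he.comp Computable.fst)
  · intro q m
    have hq : IsPairCode q.pairCode := (mem_range_pairCode _).1 ⟨q, rfl⟩
    simp only [Bool.and_eq_true, decide_eq_true_eq, encode_eq_count]
    exact ⟨fun h => Nat.count_injective h.1 hq h.2, by rintro rfl; exact ⟨hq, rfl⟩⟩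

theorem computable_den : Computable Rat.den :=
  (Computable.snd.comp (Computable.unpair.comp computable_pairCode)).of_eq fun q => by
    simp [pairCode_eq]

theorem computable_intEquivNat_num : Computable fun q : ℚ => Equiv.intEquivNat q.num :=
  (Computable.fst.comp (Computable.unpair.comp computable_pairCode)).of_eq fun q => by
    simp [pairCode_eq]

theorem computable_num_toNat : Computable fun q : ℚ => q.num.toNat := by
  have : Primrec fun k : ℕ => if k % 2 = 0 then k / 2 else 0 :=
    Primrec.ite (Primrec.eq.comp (Primrec.nat_mod.comp Primrec.id (Primrec.const 2))
      (Primrec.const 0)) (Primrec.nat_div.comp Primrec.id (Primrec.const 2)) (Primrec.const 0)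
  refine (this.to_comp.comp computable_intEquivNat_num).of_eq fun q => ?_
  simp only [intEquivNat_eq]
  split_ifs <;> omega

theorem computable_neg_num_toNat : Computable fun q : ℚ => (-q.num).toNat := by
  have : Primrec fun k : ℕ => if k % 2 = 0 then 0 else (k + 1) / 2 :=
    Primrec.ite (Primrec.eq.comp (Primrec.nat_mod.comp Primrec.id (Primrec.const 2))
      (Primrec.const 0)) (Primrec.const 0)
      (Primrec.nat_div.comp Primrec.succ (Primrec.const 2))
  refine (this.to_comp.comp computable_intEquivNat_num).of_eq fun q => ?_
  simp only [intEquivNat_eq]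
  split_ifs <;> omega

theorem eq_toNat_sub_div (q : ℚ) : q = ((q.num.toNat : ℚ) - (-q.num).toNat) / q.den := by
  have h : ((q.num.toNat : ℚ) - (-q.num).toNat) = q.num := by
    exact_mod_cast Int.toNat_sub_toNat_neg q.num
  rw [h, Rat.num_div_den]

theorem computable_sub_div {α : Type*} [Primcodable α] {a b d : α → ℕ} (ha : Computable a)
    (hb : Computable b) (hd : Computable d) (h0 : ∀ x, d x ≠ 0) :
    Computable fun x => ((a x : ℚ) - b x) / d x := by
  have add := Primrec.nat_add.to_comp
  have mul := Primrec.nat_mul.to_comp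
  have hof : Computable fun n => Denumerable.ofNat ℚ n := Computable.ofNat ℚ
  have p := computable_num_toNat.comp (hof.comp (Computable.snd (α := α)))
  have n := computable_neg_num_toNat.comp (hof.comp (Computable.snd (α := α)))
  have e := computable_den.comp (hof.comp (Computable.snd (α := α)))
  have fst := Computable.fst (α := α) (β := ℕ)
  refine Computable.encode_iff.1 (Computable.of_find (P := fun x k =>
    decide ((Denumerable.ofNat ℚ k).num.toNat * d x + b x * (Denumerable.ofNat ℚ k).den =
    a x * (Denumerable.ofNat ℚ k).den + (-(Denumerable.ofNat ℚ k).num).toNat * d x)) ?_ ?_)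
  · exact Primrec.eq.decide.to_comp.comp
      (add.comp (mul.comp p (hd.comp fst)) (mul.comp (hb.comp fst) e))
      (add.comp (mul.comp (ha.comp fst) e) (mul.comp n (hd.comp fst)))
  · intro x k
    obtain ⟨q, rfl⟩ : ∃ q : ℚ, k = @Encodable.encode ℚ Denumerable.toEncodable q :=
      ⟨Denumerable.ofNat ℚ k, (Denumerable.encode_ofNat k).symm⟩
    rw [Denumerable.ofNat_encode, decide_eq_true_eq,
      @Encodable.encode_inj ℚ Denumerable.toEncodable]
    have hq := eq_toNat_sub_div q
    have h1 : (d x : ℚ) ≠ 0 := by exact_mod_cast h0 x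
    have h2 : (q.den : ℚ) ≠ 0 := by exact_mod_cast q.den_nz
    conv_rhs => rw [hq, div_eq_div_iff h2 h1]
    rw [← Nat.cast_inj (R := ℚ)]
    push_cast
    constructor <;> intro h <;> linarith

theorem computable_add : Computable₂ ((· + ·) : ℚ → ℚ → ℚ) := by
  have add := Primrec.nat_add.to_comp
  have mul := Primrec.nat_mul.to_comp
  have p := computable_num_toNat
  have n := computable_neg_num_toNat
  have d := computable_den
  have fst := Computable.fst (α := ℚ) (β := ℚ)
  have snd := Computable.snd (α := ℚ) (β := ℚ)
  refine (computable_sub_div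
    (add.comp (mul.comp (p.comp fst) (d.comp snd)) (mul.comp (p.comp snd) (d.comp fst)))
    (add.comp (mul.comp (n.comp fst) (d.comp snd)) (mul.comp (n.comp snd) (d.comp fst)))
    (mul.comp (d.comp fst) (d.comp snd))
    fun x => mul_ne_zero x.1.den_nz x.2.den_nz).of_eq fun x => ?_
  conv_rhs => rw [eq_toNat_sub_div x.1, eq_toNat_sub_div x.2]
  have h1 : (x.1.den : ℚ) ≠ 0 := by exact_mod_cast x.1.den_nz
  have h2 : (x.2.den : ℚ) ≠ 0 := by exact_mod_cast x.2.den_nz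
  push_cast
  field_simp
  ring

theorem computable_neg : Computable (fun q : ℚ => -q) := by
  refine (computable_sub_div computable_neg_num_toNat computable_num_toNat computable_den
    fun q => q.den_nz).of_eq fun q => ?_
  conv_rhs => rw [eq_toNat_sub_div q]
  ring

theorem computable_mul : Computable₂ ((· * ·) : ℚ → ℚ → ℚ) := by
  have add := Primrec.nat_add.to_comp
  have mul := Primrec.nat_mul.to_comp
  have p := computable_num_toNat
  have n := computable_neg_num_toNat
  have d := computable_den
  have fst := Computable.fst (α := ℚ) (β := ℚ)
  have snd := Computable.snd (α := ℚ) (β := ℚ)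
  refine (computable_sub_div
    (add.comp (mul.comp (p.comp fst) (p.comp snd)) (mul.comp (n.comp fst) (n.comp snd)))
    (add.comp (mul.comp (p.comp fst) (n.comp snd)) (mul.comp (n.comp fst) (p.comp snd)))
    (mul.comp (d.comp fst) (d.comp snd))
    fun x => mul_ne_zero x.1.den_nz x.2.den_nz).of_eq fun x => ?_
  conv_rhs => rw [eq_toNat_sub_div x.1, eq_toNat_sub_div x.2]
  have h1 : (x.1.den : ℚ) ≠ 0 := by exact_mod_cast x.1.den_nz
  have h2 : (x.2.den : ℚ) ≠ 0 := by exact_mod_cast x.2.den_nz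
  push_cast
  field_simp
  ring

theorem computable_max_zero : Computable (fun q : ℚ => max 0 q) := by
  refine (computable_sub_div computable_num_toNat (Computable.const 0) computable_den
    fun q => q.den_nz).of_eq fun q => ?_
  have h2 : (0 : ℚ) < q.den := by exact_mod_cast q.pos
  rcases le_total 0 q with h | h
  · rw [max_eq_right h]
    have : (-q.num).toNat = 0 := by have := Rat.num_nonneg.2 h; omega
    conv_rhs => rw [eq_toNat_sub_div q, this]
  · rw [max_eq_left h]
    have : q.num.toNat = 0 := by have := Rat.num_nonpos.2 h; omega
    simp [this]

theorem computable_abs : Computable (fun q : ℚ => |q|) := by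
  refine (computable_add.comp computable_max_zero
    (computable_max_zero.comp computable_neg)).of_eq fun q => ?_
  rcases le_total 0 q with h | h
  · rw [max_eq_right h, max_eq_left (by linarith), abs_of_nonneg h, add_zero]
  · rw [max_eq_left h, max_eq_right (by linarith), abs_of_nonpos h, zero_add]

theorem computable_half_pow : Computable (fun n : ℕ => (1 / 2 : ℚ) ^ n) := by
  refine (Computable.nat_rec (f := id) (g := fun _ => (1 : ℚ)) (h := fun _ p => p.2 * (1 / 2))
    Computable.id (Computable.const 1)
    (computable_mul.comp (Computable.snd.comp Computable.snd) (Computable.const _))).of_eq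
    fun n => ?_
  induction n with
  | zero => simp
  | succ n ih => rw [pow_succ, ← ih]; rfl

end Rat

/-- The tent of height `(1 / 2) ^ (e + 1)` and slope `1` centred at `(1 / 2) ^ e`. -/
def tent {K : Type*} [Field K] [LinearOrder K] (e : ℕ) (x : K) : K :=
  max 0 ((1 / 2) ^ (e + 1) + -|x + -(1 / 2) ^ e|)

theorem tent_nonneg (e : ℕ) (x : ℝ) : 0 ≤ tent e x := le_max_left _ _

theorem tent_le_one (e : ℕ) (x : ℝ) : tent e x ≤ 1 := by
  have h : ((1 : ℝ) / 2) ^ (e + 1) ≤ 1 := pow_le_one₀ (by norm_num) (by norm_num)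
  have := abs_nonneg (x + -(1 / 2) ^ e)
  exact max_le zero_le_one (by linarith)

theorem abs_tent_sub_tent_le (e : ℕ) (x y : ℝ) : |tent e x - tent e y| ≤ |x - y| := by
  rw [tent, tent, max_comm 0, max_comm 0]
  refine (abs_max_sub_max_le_abs _ _ _).trans ?_
  rw [add_sub_add_left_eq_sub, neg_sub_neg, abs_sub_comm x y]
  refine (abs_abs_sub_abs_le_abs_sub _ _).trans_eq ?_
  rw [add_sub_add_right_eq_sub]

theorem tent_self (e : ℕ) : 0 < tent e ((1 / 2 : ℝ) ^ e) := by
  simp [tent]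

theorem tent_of_ne {e k : ℕ} (h : k ≠ e) : tent e ((1 / 2 : ℝ) ^ k) = 0 := by
  refine max_eq_left ?_
  have hp : (0 : ℝ) < (1 / 2) ^ e := by positivity
  rcases h.lt_or_gt with h | h
  · obtain ⟨d, rfl⟩ := Nat.exists_eq_add_of_lt h
    have h1 : ((1 : ℝ) / 2) ^ d ≤ 1 := pow_le_one₀ (by norm_num) (by norm_num)
    have hk : (0 : ℝ) < (1 / 2) ^ k := by positivity
    have := le_abs_self ((1 / 2 : ℝ) ^ k + -(1 / 2) ^ (k + d + 1))
    have e1 : ((1 : ℝ) / 2) ^ (k + d + 1) = (1 / 2) ^ k * (1 / 2) ^ d / 2 := by ring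
    have e2 : ((1 : ℝ) / 2) ^ (k + d + 1 + 1) = (1 / 2) ^ k * (1 / 2) ^ d / 4 := by ring
    rw [e1] at this ⊢
    rw [e2]
    nlinarith
  · have h1 : ((1 : ℝ) / 2) ^ k ≤ (1 / 2) ^ (e + 1) :=
      pow_le_pow_of_le_one (by norm_num) (by norm_num) h
    have := neg_abs_le ((1 / 2 : ℝ) ^ k + -(1 / 2) ^ e)
    have e2 : ((1 : ℝ) / 2) ^ (e + 1) = (1 / 2) ^ e / 2 := by ring
    rw [e2] at h1 ⊢
    linarith

theorem Rat.cast_tent (e : ℕ) (q : ℚ) : ((tent e q : ℚ) : ℝ) = tent e (q : ℝ) := by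
  simp [tent]

theorem Rat.computable_tent : Computable₂ (tent : ℕ → ℚ → ℚ) := by
  have hp := computable_half_pow
  exact computable_max_zero.comp (computable_add.comp
    (hp.comp (Computable.succ.comp Computable.fst))
    (computable_neg.comp (computable_abs.comp (computable_add.comp Computable.snd
      (computable_neg.comp (hp.comp Computable.fst))))))

/-- The `n`-th summand of the perturbation: a tent at `(1 / 2) ^ n.unpair.1` with weight `c n`. -/
def tentTerm {K : Type*} [Field K] [LinearOrder K] (c : ℕ → K) (n : ℕ) (x : K) : K :=
  (1 / 2) ^ (n + 1) * (c n * tent n.unpair.1 x)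

/-- The identity perturbed by a weighted sum of tents. -/
noncomputable def perturbedId (c : ℕ → ℝ) (x : ℝ) : ℝ := x + ∑' n, tentTerm c n x

theorem hasSum_half_pow_mul (a : ℝ) : HasSum (fun n : ℕ => (1 / 2 : ℝ) ^ (n + 1) * a) a := by
  convert hasSum_geometric_two' a using 2 with n
  rw [pow_succ, one_div, inv_pow]
  field_simp

section

variable {c : ℕ → ℝ} (hc : ∀ n, |c n| ≤ 1)
include hc

theorem abs_tentTerm_le (n : ℕ) (x : ℝ) : |tentTerm c n x| ≤ (1 / 2) ^ (n + 1) * 1 := by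
  rw [tentTerm, abs_mul, abs_mul, abs_of_pos (by positivity : (0 : ℝ) < (1 / 2) ^ (n + 1)),
    abs_of_nonneg (tent_nonneg _ _)]
  gcongr
  exact mul_le_one₀ (hc n) (tent_nonneg _ _) (tent_le_one _ _)

theorem summable_tentTerm (x : ℝ) : Summable fun n => tentTerm c n x :=
  Summable.of_norm_bounded (hasSum_half_pow_mul 1).summable fun n => abs_tentTerm_le hc n x

theorem abs_tsum_tentTerm_sub_le (x y : ℝ) :
    |∑' n, tentTerm c n x - ∑' n, tentTerm c n y| ≤ |x - y| := by
  rw [← (summable_tentTerm hc x).tsum_sub (summable_tentTerm hc y)]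
  rw [← Real.norm_eq_abs]
  refine tsum_of_norm_bounded (hasSum_half_pow_mul |x - y|) fun n => ?_
  rw [Real.norm_eq_abs, tentTerm, tentTerm, ← mul_sub, ← mul_sub, abs_mul, abs_mul,
    abs_of_pos (by positivity : (0 : ℝ) < (1 / 2) ^ (n + 1))]
  gcongr
  calc |c n| * |tent n.unpair.1 x - tent n.unpair.1 y| ≤ 1 * |x - y| :=
        mul_le_mul (hc n) (abs_tent_sub_tent_le _ _ _) (abs_nonneg _) zero_le_one
    _ = |x - y| := one_mul _

theorem monotone_perturbedId : Monotone (perturbedId c) := by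
  intro x y hxy
  have h := (abs_le.1 (abs_tsum_tentTerm_sub_le hc y x)).1
  rw [abs_of_nonneg (sub_nonneg.2 hxy)] at h
  unfold perturbedId
  linarith

theorem continuous_perturbedId : Continuous (perturbedId c) :=
  continuous_id.add (LipschitzWith.of_dist_le_mul (K := 1) fun x y => by
    simpa [Real.dist_eq] using abs_tsum_tentTerm_sub_le hc x y).continuous

theorem abs_sum_sub_perturbedId_le (s : ℕ) (x : ℝ) :
    |(x + ∑ n ∈ Finset.range s, tentTerm c n x) - perturbedId c x| ≤ (1 / 2) ^ s := by
  have h := (summable_tentTerm hc x).sum_add_tsum_nat_add s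
  have e : (x + ∑ n ∈ Finset.range s, tentTerm c n x) - perturbedId c x =
      -∑' n, tentTerm c (n + s) x := by
    unfold perturbedId
    linarith
  rw [e, abs_neg]
  rw [← Real.norm_eq_abs]
  refine tsum_of_norm_bounded (hasSum_half_pow_mul ((1 / 2) ^ s)) fun n => ?_
  exact (abs_tentTerm_le hc _ x).trans_eq (by ring)

theorem lt_perturbedId {e s : ℕ} (h0 : ∀ t, 0 ≤ c (Nat.pair e t)) (hs : 0 < c (Nat.pair e s)) :
    (1 / 2) ^ e < perturbedId c ((1 / 2) ^ e) := by
  refine lt_add_of_pos_right _ ((summable_tentTerm hc _).tsum_pos (fun n => ?_) (Nat.pair e s) ?_)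
  · rcases eq_or_ne e n.unpair.1 with rfl | h
    · have := h0 n.unpair.2
      rw [Nat.pair_unpair] at this
      exact mul_nonneg (by positivity) (mul_nonneg this (tent_nonneg _ _))
    · rw [tentTerm, tent_of_ne h, mul_zero, mul_zero]
  · rw [tentTerm, Nat.unpair_pair]
    exact mul_pos (by positivity) (mul_pos hs (tent_self e))

theorem perturbedId_lt {e s : ℕ} (h0 : ∀ t, c (Nat.pair e t) ≤ 0) (hs : c (Nat.pair e s) < 0) :
    perturbedId c ((1 / 2) ^ e) < (1 / 2) ^ e := by
  have h := lt_perturbedId (c := fun n => -c n) (e := e) (s := s) (by simpa using hc)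
    (by simpa using h0) (by simpa using hs)
  have hn : ∀ n x, tentTerm (fun n => -c n) n x = -tentTerm c n x := fun n x => by
    simp [tentTerm]
  simp only [perturbedId, hn, tsum_neg] at h ⊢
  linarith

end

theorem Rat.computable_add_sum_tentTerm {c : ℕ → ℚ} (hc : Computable c) :
    Computable₂ fun (s : ℕ) (q : ℚ) => q + ∑ n ∈ Finset.range s, tentTerm c n q := by
  have hterm : Computable₂ fun (n : ℕ) (q : ℚ) => tentTerm c n q :=
    computable_mul.comp (computable_half_pow.comp (Computable.succ.comp Computable.fst))
      (computable_mul.comp (hc.comp Computable.fst) (computable_tent.comp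
        (Computable.fst.comp (Computable.unpair.comp Computable.fst)) Computable.snd))
  refine (Computable.nat_rec (f := fun x : ℕ × ℚ => x.1) (g := fun x => x.2)
    (h := fun x p => p.2 + tentTerm c p.1 x.2) Computable.fst Computable.snd
    (computable_add.comp (Computable.snd.comp Computable.snd)
      (hterm.comp (Computable.fst.comp Computable.snd)
        (Computable.snd.comp Computable.fst)))).of_eq fun x => ?_
  obtain ⟨s, q⟩ := x
  induction s with
  | zero => simp
  | succ s ih =>
    dsimp only at ih ⊢
    rw [Finset.sum_range_succ, ← add_assoc, ← ih]

theorem stmt16 (A B : Set ℕ) (hA : CEset A) (hB : CEset B) (hdisj : Disjoint A B) :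
    ∃ f : ℝ → ℝ,
      MonotoneOn f (Set.Icc 0 1) ∧
      ContinuousOn f (Set.Icc 0 1) ∧
      -- `f` is computable: computable rational approximations with precision `2^{-s}`
      (∃ g : ℕ → ℚ → ℚ, Computable₂ g ∧ ∀ (s : ℕ) (p : ℚ), (p:ℝ) ∈ Set.Icc (0:ℝ) 1 →
        |(g s p : ℝ) - f (p:ℝ)| ≤ (2:ℝ) ^ (-(s:ℤ))) ∧
      (∀ e : ℕ, e ∈ A → f ((2:ℝ) ^ (-(e:ℤ))) < (2:ℝ) ^ (-(e:ℤ))) ∧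
      (∀ e : ℕ, e ∈ B → (2:ℝ) ^ (-(e:ℤ)) < f ((2:ℝ) ^ (-(e:ℤ)))) ∧
      -- consequently, any oracle deciding the comparisons yields a separating set:
      ∀ X : ℕ → Bool,
        (∀ e : ℕ, (X e = true → f ((2:ℝ) ^ (-(e:ℤ))) ≤ (2:ℝ) ^ (-(e:ℤ))) ∧
          (X e = false → (2:ℝ) ^ (-(e:ℤ)) ≤ f ((2:ℝ) ^ (-(e:ℤ))))) →
        (∀ e ∈ A, X e = true) ∧ (∀ e ∈ B, X e = false) := by
  obtain ⟨a, ha, hA⟩ := hA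
  obtain ⟨b, hb, hB⟩ := hB
  have hpow : ∀ e : ℕ, (2 : ℝ) ^ (-(e : ℤ)) = (1 / 2) ^ e := fun e => by
    rw [zpow_neg, zpow_natCast, one_div, inv_pow]
  simp only [hpow]
  let c : ℕ → ℚ := fun n => bif a n.unpair.1 n.unpair.2 then -1 else
    bif b n.unpair.1 n.unpair.2 then 1 else 0
  have hc : Computable c := by
    have hu := Computable.fst.comp Computable.unpair
    have hv := Computable.snd.comp Computable.unpair
    exact Computable.cond (ha.comp hu hv) (Computable.const _)
      (Computable.cond (hb.comp hu hv) (Computable.const _) (Computable.const _))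
  have hle : ∀ n, |(c n : ℝ)| ≤ 1 := fun n => by
    simp only [c]
    cases a n.unpair.1 n.unpair.2 <;> cases b n.unpair.1 n.unpair.2 <;> simp
  have hlt : ∀ e ∈ A, perturbedId (fun n => (c n : ℝ)) ((1 / 2) ^ e) < (1 / 2) ^ e := by
    intro e he
    have hbf : ∀ t, b e t = false := fun t => by
      by_contra h
      exact Set.disjoint_left.1 hdisj he ((hB e).2 ⟨t, by simpa using h⟩)
    obtain ⟨s, hs⟩ := (hA e).1 he
    refine perturbedId_lt hle (s := s) (fun t => ?_) ?_
    · simp only [c, Nat.unpair_pair, hbf]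
      cases a e t <;> simp
    · simp [c, hs]
  have hgt : ∀ e ∈ B, (1 / 2) ^ e < perturbedId (fun n => (c n : ℝ)) ((1 / 2) ^ e) := by
    intro e he
    have haf : ∀ t, a e t = false := fun t => by
      by_contra h
      exact Set.disjoint_left.1 hdisj ((hA e).2 ⟨t, by simpa using h⟩) he
    obtain ⟨s, hs⟩ := (hB e).1 he
    refine lt_perturbedId hle (s := s) (fun t => ?_) ?_
    · simp only [c, Nat.unpair_pair, haf]
      cases b e t <;> simp
    · simp [c, hs, haf]
  refine ⟨perturbedId fun n => (c n : ℝ), (monotone_perturbedId hle).monotoneOn _,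
    (continuous_perturbedId hle).continuousOn, ⟨_, Rat.computable_add_sum_tentTerm hc, ?_⟩,
    hlt, hgt, fun X hX => ⟨fun e he => ?_, fun e he => ?_⟩⟩
  · intro s p _
    have h := abs_sum_sub_perturbedId_le hle s p
    simpa [tentTerm, Rat.cast_tent] using h
  · by_contra h
    exact (hlt e he).not_ge ((hX e).2 (by simpa using h))
  · by_contra h
    exact (hgt e he).not_ge ((hX e).1 (by simpa using h))
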